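/- Let t_K ⊂ t be the C-span of the cascade K (equivalently, t_K = ⊕_{i=1}^m C·[e_{β_i}, e_{-β_i}]). Then t_K contains a regular semisimple element of g, i.e., there exists h ∈ t_K with γ(h) ≠ 0 for every γ ∈ Δ. -/

import Mathlib

open scoped RealInnerProductSpace

attribute [local instance] Classical.propDecidable

section RootCombinatorics

variable {V : Type*} [NormedAddCommGroup V] [InnerProductSpace ℝ V]

/-- The Cartan pairing `⟨γ, α∨⟩ = 2 (γ, α) / (α, α)`. -/
noncomputable def cartanPairing (γ α : V) : ℝ := 2 * ⟪γ, α⟫ / ⟪α, α⟫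

/-- The coroot `γ∨ = 2 γ / (γ, γ)`. -/
noncomputable def covec (γ : V) : V := (2 / ⟪γ, γ⟫) • γ

/-- The cascade element `x_K = Σ_{β ∈ K} β / (β, β) = ½ Σ_{β ∈ K} β∨`. -/
noncomputable def cascElt (K : Finset V) : V := ∑ β ∈ K, (⟪β, β⟫)⁻¹ • β

/-- The roots of `S` orthogonal to `β`. -/
noncomputable def orthSub (S : Finset V) (β : V) : Finset V := S.filter fun γ => ⟪γ, β⟫ = 0

/-- One step of the non-orthogonality (connectedness) relation inside `S`. -/
def connRel (S : Finset V) (a b : V) : Prop := a ∈ S ∧ b ∈ S ∧ ⟪a, b⟫ ≠ 0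

/-- The irreducible component of the root subsystem `S` containing `γ`. -/
noncomputable def component (S : Finset V) (γ : V) : Finset V :=
  S.filter fun γ' => Relation.ReflTransGen (connRel S) γ γ'

/-- `C` is an irreducible component of the root subsystem `S`. -/
def IsComponent (S C : Finset V) : Prop := ∃ γ ∈ S, C = component S γ

end RootCombinatorics

/-- The combinatorial data of an irreducible crystallographic root system with a chosen
system of positive roots, base (set of simple roots) and highest root: the combinatorial
skeleton of a finite-dimensional complex simple Lie algebra, with the Killing-form
identification of the Cartan subalgebra and its dual. -/
structure RootSystemCtx (V : Type*) [NormedAddCommGroup V] [InnerProductSpace ℝ V] where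
  /-- the set of roots Δ -/
  Δ : Finset V
  /-- the set of simple roots Π -/
  base : Finset V
  /-- the set of positive roots Δ⁺ -/
  Pos : Finset V
  /-- the highest root θ -/
  θ : V
  zero_not_mem : (0 : V) ∉ Δ
  neg_mem : ∀ γ ∈ Δ, -γ ∈ Δ
  reflect_mem : ∀ α ∈ Δ, ∀ γ ∈ Δ, γ - cartanPairing γ α • α ∈ Δ
  pairing_int : ∀ α ∈ Δ, ∀ γ ∈ Δ, ∃ k : ℤ, cartanPairing γ α = (k : ℝ)
  span_eq : Submodule.span ℝ (Δ : Set V) = ⊤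
  base_subset : base ⊆ Pos
  base_indep : LinearIndependent ℝ (fun a : {x // x ∈ base} => (a : V))
  pos_subset : Pos ⊆ Δ
  pos_or_neg : ∀ γ ∈ Δ, γ ∈ Pos ∨ -γ ∈ Pos
  pos_not_neg : ∀ γ ∈ Pos, -γ ∉ Pos
  pos_coords : ∀ γ ∈ Pos, γ ∈ AddSubmonoid.closure (base : Set V)
  irreducible : ∀ S : Finset V, S ⊆ Δ → S.Nonempty →
    (∀ a ∈ S, ∀ b ∈ Δ, b ∉ S → ⟪a, b⟫ = 0) → S = Δ
  theta_mem : θ ∈ Pos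
  theta_highest : ∀ γ ∈ Δ, θ - γ ∈ AddSubmonoid.closure (base : Set V)

namespace RootSystemCtx

variable {V : Type*} [NormedAddCommGroup V] [InnerProductSpace ℝ V]

variable (ctx : RootSystemCtx V)

/-- The root order `γ ≼ γ'` on roots: `γ' - γ` is a nonnegative integral combination of
simple roots. -/
def rootLE (γ γ' : V) : Prop := γ' - γ ∈ AddSubmonoid.closure (ctx.base : Set V)

/-- `β` is the highest root of the root subsystem `S` (with respect to the ambient positive
system). -/
def IsHighest (S : Finset V) (β : V) : Prop :=
  β ∈ S ∧ β ∈ ctx.Pos ∧ ∀ γ ∈ S, ctx.rootLE γ β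

/-- `CascadeMem ctx S β` : the pair (root subsystem `S = Δ⟨i⟩`, its highest root `β = βᵢ`)
occurs in the recursive construction of the Kostant cascade: one starts with `(Δ, θ)`, and the
descendants of `(S, β)` are the pairs `(C, β')` where `C` is an irreducible component of
`{γ ∈ S | (γ, β) = 0}` and `β'` is the highest root of `C`. -/
inductive CascadeMem : Finset V → V → Prop
  | top : CascadeMem ctx.Δ ctx.θ
  | step {S C : Finset V} {β β' : V} : CascadeMem S β →
      IsComponent (orthSub S β) C → ctx.IsHighest C β' → CascadeMem C β'

/-- `K` is the Kostant cascade of the root system. -/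
def IsCascade (K : Finset V) : Prop := ∀ β, β ∈ K ↔ ∃ S, ctx.CascadeMem S β

/-- The Heisenberg subset `H_β = {γ ∈ S ∩ Δ⁺ : (γ, β) > 0}` attached to a cascade pair
`(S, β)`. -/
noncomputable def heis (S : Finset V) (β : V) : Finset V :=
  S.filter fun γ => γ ∈ ctx.Pos ∧ 0 < ⟪γ, β⟫

/-- A root is long if it has the same length as the highest root. -/
def IsLong (γ : V) : Prop := ⟪γ, γ⟫ = ⟪ctx.θ, ctx.θ⟫

/-- The highest root `θ` is a fundamental weight. -/
def ThetaFundamental : Prop :=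
  ∃ α ∈ ctx.base, cartanPairing ctx.θ α = 1 ∧
    ∀ β ∈ ctx.base, β ≠ α → cartanPairing ctx.θ β = 0

/-- `β'` is a descendant of the cascade element `β`. -/
def Desc (β β' : V) : Prop :=
  ∃ S C, ctx.CascadeMem S β ∧ IsComponent (orthSub S β) C ∧ ctx.IsHighest C β'

/-- The cascade poset order: `β ≤ β'` iff `β` is an iterated descendant of `β'`. -/
def cascLE (β β' : V) : Prop := Relation.ReflTransGen (fun a b => ctx.Desc b a) β β'

/-- A simple reflection of the root system. -/
def IsSimpleReflection (w : V ≃ₗ[ℝ] V) : Prop :=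
  ∃ α ∈ ctx.base, ∀ v, w v = v - (2 * ⟪v, α⟫ / ⟪α, α⟫) • α

/-- The Weyl group, generated by the simple reflections. -/
def weylGroup : Subgroup (V ≃ₗ[ℝ] V) := Subgroup.closure {w | ctx.IsSimpleReflection w}

/-- The length of a Weyl group element: the minimal number of simple reflections needed to
express it. -/
noncomputable def length (w : V ≃ₗ[ℝ] V) : ℕ :=
  sInf {n | ∃ l : List (V ≃ₗ[ℝ] V), l.length = n ∧
    (∀ s ∈ l, ctx.IsSimpleReflection s) ∧ l.prod = w}

/-- The root system is of type `Aₙ` (Cartan matrix characterisation). -/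
def IsTypeA (n : ℕ) : Prop :=
  1 ≤ n ∧ ∃ e : Fin n ≃ {x // x ∈ ctx.base}, ∀ i j : Fin n,
    cartanPairing (e i : V) (e j : V) =
      (if i = j then 2 else if i.val + 1 = j.val ∨ j.val + 1 = i.val then -1 else 0)

/-- The root system is of type `Bₙ` (`n ≥ 2`), with the last simple root short. -/
def IsTypeB (n : ℕ) : Prop :=
  2 ≤ n ∧ ∃ e : Fin n ≃ {x // x ∈ ctx.base}, ∀ i j : Fin n,
    cartanPairing (e i : V) (e j : V) =
      (if i = j then 2
       else if i.val + 2 = n ∧ j.val + 1 = n then -2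
       else if i.val + 1 = j.val ∨ j.val + 1 = i.val then -1 else 0)

/-- The root system is of type `Cₙ` (`n ≥ 2`), with the last simple root long. -/
def IsTypeC (n : ℕ) : Prop :=
  2 ≤ n ∧ ∃ e : Fin n ≃ {x // x ∈ ctx.base}, ∀ i j : Fin n,
    cartanPairing (e i : V) (e j : V) =
      (if i = j then 2
       else if i.val + 1 = n ∧ j.val + 2 = n then -2
       else if i.val + 1 = j.val ∨ j.val + 1 = i.val then -1 else 0)

/-- The root system is of type `G₂` (first simple root short). -/
def IsTypeG2 : Prop :=
  ∃ e : Fin 2 ≃ {x // x ∈ ctx.base},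
    cartanPairing (e 0 : V) (e 0 : V) = 2 ∧ cartanPairing (e 1 : V) (e 1 : V) = 2 ∧
    cartanPairing (e 0 : V) (e 1 : V) = -1 ∧ cartanPairing (e 1 : V) (e 0 : V) = -3

/-- The set of roots `Δ(a_z) = w(Δ⁺_z(-1)) ∪ w(-Δ⁺_z(2))` of the abelian ideal attached by
Kostant's construction to `z` (with `w = w_z`). -/
def idealSet (w : V ≃ₗ[ℝ] V) (x : V) : Set V :=
  {δ | ∃ γ ∈ ctx.Pos, (⟪γ, x⟫ = -1 ∧ δ = w γ) ∨ (⟪γ, x⟫ = 2 ∧ δ = -(w γ))}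

end RootSystemCtx

/-- A root-space decomposition of a finite-dimensional complex Lie algebra `g` compatible
with the root-system data `ctx`: a Cartan subalgebra `t`, root vectors `e γ` for `γ ∈ Δ`,
and the Killing identification `coh : V → t` of the rational/real form of the Cartan
subalgebra with the Euclidean space `V` carrying the root system. -/
structure LieRootData {V : Type*} [NormedAddCommGroup V] [InnerProductSpace ℝ V]
    (ctx : RootSystemCtx V) (g : Type*) [LieRing g] [LieAlgebra ℂ g] where
  t : LieSubalgebra ℂ g
  e : V → g
  coh : V → g
  coh_add : ∀ v w, coh (v + w) = coh v + coh w
  coh_smul : ∀ (r : ℝ) (v : V), coh (r • v) = (r : ℂ) • coh v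
  coh_inj : ∀ v, coh v = 0 → v = 0
  coh_mem : ∀ v, coh v ∈ t
  t_span : t.toSubmodule = Submodule.span ℂ (Set.range coh)
  t_abelian : ∀ x ∈ t, ∀ y ∈ t, ⁅x, y⁆ = (0 : g)
  e_ne : ∀ γ ∈ ctx.Δ, e γ ≠ 0
  bracket_coh_e : ∀ (v : V), ∀ γ ∈ ctx.Δ, ⁅coh v, e γ⁆ = (⟪γ, v⟫ : ℂ) • e γ
  bracket_e_e_root : ∀ γ ∈ ctx.Δ, ∀ δ ∈ ctx.Δ, γ + δ ∈ ctx.Δ →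
    ∃ c : ℂ, c ≠ 0 ∧ ⁅e γ, e δ⁆ = c • e (γ + δ)
  bracket_e_e_neg : ∀ γ ∈ ctx.Δ, ∃ c : ℂ, c ≠ 0 ∧ ⁅e γ, e (-γ)⁆ = c • coh γ
  bracket_e_e_zero : ∀ γ ∈ ctx.Δ, ∀ δ ∈ ctx.Δ, γ + δ ∉ ctx.Δ → γ + δ ≠ 0 → ⁅e γ, e δ⁆ = 0
  span_top : (⊤ : Submodule ℂ g) = t.toSubmodule ⊔ Submodule.span ℂ (e '' (ctx.Δ : Set V))
  dim_eq : Module.finrank ℂ g = Module.finrank ℂ ↥t + ctx.Δ.card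
  rank_eq : Module.finrank ℂ ↥t = ctx.base.card

namespace RootSystemCtx

variable {V : Type*} [NormedAddCommGroup V] [InnerProductSpace ℝ V] (ctx : RootSystemCtx V)

/-- A finite set of vectors is reflection-closed if it is stable under the reflections in its
members. -/
def ReflClosed (C : Finset V) : Prop := ∀ α ∈ C, ∀ γ ∈ C, γ - cartanPairing γ α • α ∈ C

/-- There is a height function: a linear functional positive on the positive roots. -/
theorem exists_height : ∃ f : V →ₗ[ℝ] ℝ, ∀ γ ∈ ctx.Pos, 0 < f γ := by
  obtain ⟨f, hf⟩ := LinearMap.exists_extend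
    ((Module.Basis.span ctx.base_indep).constr ℝ (fun _ => (1 : ℝ)))
  have hb : ∀ b ∈ ctx.base, f b = 1 := by
    intro b hb
    have h := congrArg (fun L => L (Module.Basis.span ctx.base_indep ⟨b, hb⟩)) hf
    simp only [LinearMap.comp_apply, Module.Basis.constr_basis, Submodule.subtype_apply] at h
    rwa [Module.Basis.span_apply] at h
  have key : ∀ x ∈ AddSubmonoid.closure (ctx.base : Set V), x = 0 ∨ 0 < f x := by
    intro x hx
    induction hx using AddSubmonoid.closure_induction with
    | mem x hx => exact Or.inr (by rw [hb x hx]; exact one_pos)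
    | zero => exact Or.inl rfl
    | add x y _ _ hx hy =>
      rcases hx with rfl | hx
      · simpa using hy
      · rcases hy with rfl | hy
        · exact Or.inr (by simpa using hx)
        · exact Or.inr (by rw [map_add]; exact add_pos hx hy)
  refine ⟨f, fun γ hγ => (key γ (ctx.pos_coords γ hγ)).resolve_left ?_⟩
  rintro rfl
  exact ctx.zero_not_mem (ctx.pos_subset hγ)

variable {ctx}

theorem inner_self_pos {α : V} (hα : α ∈ ctx.Δ) : 0 < ⟪α, α⟫ :=
  real_inner_self_pos.2 fun h => ctx.zero_not_mem (h ▸ hα)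

theorem ReflClosed.neg_mem {C : Finset V} (hC : ReflClosed C) (hsub : C ⊆ ctx.Δ) {γ : V}
    (hγ : γ ∈ C) : -γ ∈ C := by
  have h := hC γ hγ γ hγ
  have h2 : cartanPairing γ γ = 2 := by
    have := (inner_self_pos (hsub hγ)).ne'
    unfold cartanPairing; field_simp
  rw [h2, two_smul] at h
  convert h using 1
  abel

theorem ReflClosed.delta : ReflClosed ctx.Δ := fun α hα γ hγ => ctx.reflect_mem α hα γ hγ

theorem cartanPairing_pos_iff {α : V} (hα : α ∈ ctx.Δ) (γ : V) :
    0 < cartanPairing γ α ↔ 0 < ⟪γ, α⟫ := by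
  have := inner_self_pos hα
  unfold cartanPairing
  rw [div_pos_iff_of_pos_right this]
  constructor <;> intro <;> linarith

theorem cartanPairing_neg_iff {α : V} (hα : α ∈ ctx.Δ) (γ : V) :
    cartanPairing γ α < 0 ↔ ⟪γ, α⟫ < 0 := by
  have := inner_self_pos hα
  unfold cartanPairing
  rw [div_neg_iff]
  constructor
  · rintro (h | h) <;> linarith
  · intro h; exact Or.inr ⟨by linarith, this⟩

theorem inner_reflect {α : V} (hα : α ∈ ctx.Δ) (γ : V) :
    ⟪γ - cartanPairing γ α • α, α⟫ = -⟪γ, α⟫ := by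
  have := (inner_self_pos hα).ne'
  rw [inner_sub_left, real_inner_smul_left]
  unfold cartanPairing
  field_simp
  ring

/-- If two distinct roots have positive inner product, their difference is a root. -/
theorem ReflClosed.sub_mem {C : Finset V} (hC : ReflClosed C) (hsub : C ⊆ ctx.Δ) {α γ : V}
    (hα : α ∈ C) (hγ : γ ∈ C) (hpos : 0 < ⟪γ, α⟫) (hne : γ ≠ α) : γ - α ∈ C := by
  have hpos' : 0 < ⟪α, γ⟫ := by rwa [real_inner_comm]
  obtain ⟨p, hp⟩ := ctx.pairing_int α (hsub hα) γ (hsub hγ)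
  obtain ⟨q, hq⟩ := ctx.pairing_int γ (hsub hγ) α (hsub hα)
  have p0 : 0 < p := by
    exact_mod_cast hp ▸ (cartanPairing_pos_iff (hsub hα) γ).2 hpos
  have q0 : 0 < q := by
    exact_mod_cast hq ▸ (cartanPairing_pos_iff (hsub hγ) α).2 hpos'
  by_cases h1 : p = 1
  · simpa [hp, h1] using hC α hα γ hγ
  by_cases h2 : q = 1
  · have := hC.neg_mem hsub (by simpa [hq, h2] using hC γ hγ α hα)
    simpa using this
  exfalso
  have hp2 : (2 : ℝ) ≤ p := by exact_mod_cast (show 2 ≤ p by omega)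
  have hq2 : (2 : ℝ) ≤ q := by exact_mod_cast (show 2 ≤ q by omega)
  rw [← hp, cartanPairing, le_div_iff₀ (inner_self_pos (hsub hα))] at hp2
  rw [← hq, cartanPairing, le_div_iff₀ (inner_self_pos (hsub hγ))] at hq2
  have hz : ⟪γ - α, γ - α⟫ ≤ 0 := by
    rw [real_inner_sub_sub_self]
    have hcomm := real_inner_comm α γ
    linarith
  exact hne (sub_eq_zero.1 (by rwa [← real_inner_self_nonpos]))

/-- An irreducible reflection-closed set of roots has a highest root. -/
theorem ReflClosed.exists_isHighest {C : Finset V} (hC : ReflClosed C) (hsub : C ⊆ ctx.Δ)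
    (hne : C.Nonempty)
    (hirr : ∀ A ⊆ C, A.Nonempty → (∀ a ∈ A, ∀ b ∈ C, b ∉ A → ⟪a, b⟫ = 0) → A = C) :
    ∃ β, ctx.IsHighest C β := by
  obtain ⟨ht, htpos⟩ := ctx.exists_height
  obtain ⟨β, hβ, hmax⟩ := C.exists_max_image ht hne
  have reflect_ht : ∀ γ ∈ C, ∀ α ∈ ctx.Pos, α ∈ C → ⟪γ, α⟫ < 0 →
      ht γ < ht (γ - cartanPairing γ α • α) := by
    intro γ _ α hα hαC h
    rw [map_sub, map_smul, smul_eq_mul]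
    nlinarith [htpos α hα, (cartanPairing_neg_iff (hsub hαC) γ).2 h]
  have pos_of_dom : ∀ γ ∈ C, (∀ α ∈ C, α ∈ ctx.Pos → 0 ≤ ⟪γ, α⟫) → γ ∈ ctx.Pos := by
    intro γ hγ hd
    refine (ctx.pos_or_neg γ (hsub hγ)).resolve_right fun hn => ?_
    have := hd _ (hC.neg_mem hsub hγ) hn
    rw [inner_neg_right] at this
    linarith [inner_self_pos (hsub hγ)]
  have hdom : ∀ α ∈ C, α ∈ ctx.Pos → 0 ≤ ⟪β, α⟫ := by
    intro α hα hαp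
    by_contra! h
    exact absurd (hmax _ (hC α hα β hβ)) (reflect_ht β hβ α hαp hα h).not_ge
  have hβp := pos_of_dom β hβ hdom
  -- the monoid generated by the positive members of `C`, and its face generated by `β`
  set N : AddSubmonoid V := AddSubmonoid.closure {γ | γ ∈ C ∧ γ ∈ ctx.Pos}
  have hgen : ∀ γ ∈ C, γ ∈ ctx.Pos → γ ∈ N :=
    fun γ h h' => AddSubmonoid.subset_closure ⟨h, h'⟩
  have hNbase : N ≤ AddSubmonoid.closure (ctx.base : Set V) :=
    AddSubmonoid.closure_le.2 fun γ h => ctx.pos_coords γ h.2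
  set F : V → Prop := fun x => x ∈ N ∧ ∃ n : ℕ, n • β - x ∈ N
  have F_add : ∀ x y, F x → F y → F (x + y) := by
    rintro x y ⟨hx, n, hn⟩ ⟨hy, m, hm⟩
    refine ⟨add_mem hx hy, n + m, ?_⟩
    rw [add_smul, add_sub_add_comm]
    exact add_mem hn hm
  have F_face : ∀ x y, x ∈ N → F (x + y) → y ∈ N → F x := by
    rintro x y hx ⟨_, n, hn⟩ hy
    refine ⟨hx, n, ?_⟩
    convert add_mem hn hy using 1
    abel
  have F_smul : ∀ (k : ℤ) (x : V), 0 < k → F x → F ((k : ℝ) • x) := by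
    rintro k x hk ⟨hx, n, hn⟩
    lift k to ℕ using hk.le
    have h : (((k : ℤ) : ℝ)) • x = k • x := by
      rw [Int.cast_natCast, Nat.cast_smul_eq_nsmul]
    rw [h]
    refine ⟨nsmul_mem hx k, k * n, ?_⟩
    rw [mul_smul, ← smul_sub]
    exact nsmul_mem hn k
  have Fβ : F β := ⟨hgen β hβ hβp, 1, by simp [N.zero_mem]⟩
  -- positive roots outside the face stay positive and outside after reflection in the face
  have reflect_out : ∀ f ∈ C, f ∈ ctx.Pos → F f → ∀ δ ∈ C, δ ∈ ctx.Pos → ¬ F δ → 0 < ⟪δ, f⟫ →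
      δ - cartanPairing δ f • f ∈ ctx.Pos ∧ ¬ F (δ - cartanPairing δ f • f) := by
    intro f hf hfp hfF δ hδ hδp hδF hpos
    obtain ⟨k, hk⟩ := ctx.pairing_int f (hsub hf) δ (hsub hδ)
    have k0 : 0 < k := by
      exact_mod_cast hk ▸ (cartanPairing_pos_iff (hsub hf) δ).2 hpos
    have hr := hC f hf δ hδ
    rw [hk] at hr ⊢
    have hkf := F_smul k f k0 hfF
    constructor
    · refine (ctx.pos_or_neg _ (hsub hr)).resolve_right fun hn => hδF ?_
      refine F_face δ _ (hgen δ hδ hδp) ?_ (hgen _ (hC.neg_mem hsub hr) hn)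
      convert hkf using 1
      abel
    · intro h
      refine hδF ?_
      convert F_add _ _ h hkf using 1
      abel
  have orth : ∀ δ ∈ C, δ ∈ ctx.Pos → ¬ F δ → ∀ f ∈ C, f ∈ ctx.Pos → F f → ⟪δ, f⟫ = 0 := by
    by_contra! hcon
    obtain ⟨δ₀, h₀, h₀p, h₀F, f₀, hf₀, hf₀p, hf₀F, h₀ne⟩ := hcon
    obtain ⟨δ, hδ, hmin⟩ := (C.filter fun δ => δ ∈ ctx.Pos ∧ ¬ F δ ∧
      ∃ f ∈ C, f ∈ ctx.Pos ∧ F f ∧ ⟪δ, f⟫ ≠ 0).exists_min_image ht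
      ⟨δ₀, by simp only [Finset.mem_filter]; exact ⟨h₀, h₀p, h₀F, f₀, hf₀, hf₀p, hf₀F, h₀ne⟩⟩
    simp only [Finset.mem_filter] at hδ hmin
    obtain ⟨hδ, hδp, hδF, f₁, hf₁, hf₁p, hf₁F, hne₁⟩ := hδ
    have hle : ∀ f ∈ C, f ∈ ctx.Pos → F f → ⟪f, δ⟫ ≤ 0 := by
      intro f hf hfp hfF
      by_contra! hpos
      rw [real_inner_comm] at hpos
      obtain ⟨hp, hn⟩ := reflect_out f hf hfp hfF δ hδ hδp hδF hpos
      have := hmin _ ⟨hC f hf δ hδ, hp, hn, f, hf, hfp, hfF, by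
        rw [inner_reflect (hsub hf)]; linarith⟩
      rw [map_sub, map_smul, smul_eq_mul] at this
      nlinarith [htpos f hfp, (cartanPairing_pos_iff (hsub hf) δ).2 hpos]
    have hleN : ∀ x ∈ N, F x → ⟪x, δ⟫ ≤ 0 := by
      intro x hx
      induction hx using AddSubmonoid.closure_induction with
      | mem x hx => exact hle x hx.1 hx.2
      | zero => simp
      | add x y hx hy ihx ihy =>
        intro h
        rw [inner_add_left]
        have h1 := ihx (F_face x y hx h hy)
        have h2 := ihy (F_face y x hy (by rwa [add_comm]) hx)
        linarith
    obtain ⟨n, hn⟩ := hf₁F.2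
    have h1 := hleN _ hn ⟨hn, n, by simpa using hf₁F.1⟩
    rw [inner_sub_left, ← Nat.cast_smul_eq_nsmul ℝ, real_inner_smul_left] at h1
    have h2 := hle f₁ hf₁ hf₁p hf₁F
    have h3 := mul_nonneg (Nat.cast_nonneg (α := ℝ) n) (hdom δ hδ hδp)
    rw [real_inner_comm] at hne₁
    exact hne₁ (by linarith)
  have hall : (C.filter fun γ => F γ ∨ F (-γ)) = C := by
    refine hirr _ (Finset.filter_subset _ _) ⟨β, by simp [hβ, Fβ]⟩ ?_
    intro a ha b hb hbn
    simp only [Finset.mem_filter, hb, true_and, not_or] at ha hbn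
    obtain ⟨haC, ha⟩ := ha
    have signed : ∀ f ∈ C, F f → ⟪b, f⟫ = 0 := by
      intro f hf hfF
      have hfp : f ∈ ctx.Pos := by
        refine (ctx.pos_or_neg f (hsub hf)).resolve_right fun hn => ?_
        have hNpos : ∀ x ∈ N, 0 ≤ ht x := by
          intro x hx
          induction hx using AddSubmonoid.closure_induction with
          | mem x hx => exact (htpos x hx.2).le
          | zero => simp
          | add x y _ _ hx hy => rw [map_add]; exact add_nonneg hx hy
        have h1 := hNpos f hfF.1
        have h2 := htpos _ hn
        rw [map_neg] at h2
        linarith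
      rcases ctx.pos_or_neg b (hsub hb) with hbp | hbp
      · exact orth b hb hbp hbn.1 f hf hfp hfF
      · have := orth (-b) (hC.neg_mem hsub hb) hbp hbn.2 f hf hfp hfF
        rwa [inner_neg_left, neg_eq_zero] at this
    rw [real_inner_comm]
    rcases ha with ha | ha
    · exact signed a haC ha
    · have := signed _ (hC.neg_mem hsub haC) ha
      rwa [inner_neg_right, neg_eq_zero] at this
  refine ⟨β, hβ, hβp, ?_⟩
  suffices h : ∀ γ ∈ C, β - γ ∈ N from fun γ hγ => hNbase (h γ hγ)
  by_contra! hcon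
  obtain ⟨γ₀, h₀, h₀n⟩ := hcon
  obtain ⟨γ, hγ, hγmax⟩ := (C.filter fun γ => β - γ ∉ N).exists_max_image ht
    ⟨γ₀, by simp [h₀, h₀n]⟩
  simp only [Finset.mem_filter] at hγ hγmax
  obtain ⟨hγ, hγn⟩ := hγ
  have hγdom : ∀ α ∈ C, α ∈ ctx.Pos → 0 ≤ ⟪γ, α⟫ := by
    intro α hα hαp
    by_contra! h
    have hlt := reflect_ht γ hγ α hαp hα h
    have hmem : β - (γ - cartanPairing γ α • α) ∈ N := by
      by_contra hn
      exact absurd (hγmax _ ⟨hC α hα γ hγ, hn⟩) hlt.not_ge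
    obtain ⟨k, hk⟩ := ctx.pairing_int α (hsub hα) γ (hsub hγ)
    have k0 : k < 0 := by
      exact_mod_cast hk ▸ (cartanPairing_neg_iff (hsub hα) γ).2 h
    rw [hk] at hmem
    obtain ⟨m, hm⟩ := Int.eq_ofNat_of_zero_le (show 0 ≤ -k by omega)
    have hm' : (k : ℝ) = -(m : ℝ) := by
      have : (k : ℤ) = -(m : ℤ) := by omega
      rw [this]; push_cast; rfl
    refine hγn ?_
    convert add_mem hmem (nsmul_mem (hgen α hα hαp) m) using 1
    rw [hm', neg_smul, Nat.cast_smul_eq_nsmul]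
    abel
  have hγp := pos_of_dom γ hγ hγdom
  have hγF : ∃ n : ℕ, n • β - γ ∈ N := by
    have hm : γ ∈ C.filter fun γ => F γ ∨ F (-γ) := by rwa [hall]
    rcases (Finset.mem_filter.1 hm).2 with h | ⟨h, n, hn⟩
    · exact h.2
    · refine ⟨0, ?_⟩
      rwa [zero_smul, zero_sub]
  obtain ⟨n, hn⟩ := hγF
  have hNγ : ∀ x ∈ N, 0 ≤ ⟪γ, x⟫ := by
    intro x hx
    induction hx using AddSubmonoid.closure_induction with
    | mem x hx => exact hγdom x hx.1 hx.2
    | zero => simp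
    | add x y _ _ hx hy => rw [inner_add_right]; exact add_nonneg hx hy
  have hβγ : 0 < ⟪β, γ⟫ := by
    have h1 := hNγ _ hn
    rw [inner_sub_right, ← Nat.cast_smul_eq_nsmul ℝ, real_inner_smul_right,
      real_inner_comm β γ] at h1
    by_contra! h
    nlinarith [inner_self_pos (hsub hγ), Nat.cast_nonneg (α := ℝ) n]
  have hneq : β ≠ γ := by
    rintro rfl
    exact hγn (by simp [N.zero_mem])
  have hd := hC.sub_mem hsub hγ hβ hβγ hneq
  rcases ctx.pos_or_neg _ (hsub hd) with h | h
  · exact hγn (hgen _ hd h)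
  · have h1 := htpos _ h
    rw [map_neg, map_sub] at h1
    linarith [hmax γ hγ]

theorem ReflClosed.orthSub {S : Finset V} (hS : ReflClosed S) (β : V) :
    ReflClosed (orthSub S β) := by
  intro α hα γ hγ
  simp only [_root_.orthSub, Finset.mem_filter] at hα hγ ⊢
  exact ⟨hS α hα.1 γ hγ.1, by simp [inner_sub_left, real_inner_smul_left, hα.2, hγ.2]⟩

theorem ReflClosed.component {S : Finset V} (hS : ReflClosed S) (hsub : S ⊆ ctx.Δ) (γ₀ : V) :
    ReflClosed (component S γ₀) := by
  intro α hα γ hγ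
  simp only [_root_.component, Finset.mem_filter] at hα hγ ⊢
  have hmem := hS α hα.1 γ hγ.1
  refine ⟨hmem, ?_⟩
  by_cases h : ⟪γ, α⟫ = 0
  · simpa [cartanPairing, h] using hγ.2
  · refine hα.2.tail ⟨hα.1, hmem, ?_⟩
    rw [real_inner_comm, inner_reflect (hsub hα.1)]
    exact neg_ne_zero.2 h

theorem component_irreducible {S : Finset V} (γ₀ : V) {A : Finset V}
    (hA : A ⊆ component S γ₀) (hne : A.Nonempty)
    (horth : ∀ a ∈ A, ∀ b ∈ component S γ₀, b ∉ A → ⟪a, b⟫ = 0) : A = component S γ₀ := by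
  obtain ⟨a₀, ha₀⟩ := hne
  have : Std.Symm (connRel S) :=
    ⟨fun x y ⟨hx, hy, h⟩ => ⟨hy, hx, by rwa [real_inner_comm]⟩⟩
  refine hA.antisymm fun b hb => ?_
  have h₀ := (Finset.mem_filter.1 (hA ha₀)).2
  have hab : Relation.ReflTransGen (connRel S) a₀ b :=
    (Relation.ReflTransGen.stdSymm.symm _ _ h₀).trans (Finset.mem_filter.1 hb).2
  clear hb
  induction hab with
  | refl => exact ha₀
  | @tail x y _ hxy hx =>
    by_contra hy
    refine hxy.2.2 (horth x hx y (Finset.mem_filter.2 ⟨hxy.2.1, ?_⟩) hy)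
    exact (Finset.mem_filter.1 (hA hx)).2.tail hxy

theorem CascadeMem.subset_mem_reflClosed {S : Finset V} {β : V} (h : ctx.CascadeMem S β) :
    S ⊆ ctx.Δ ∧ β ∈ S ∧ ReflClosed S := by
  induction h with
  | top => exact ⟨Finset.Subset.refl _, ctx.pos_subset ctx.theta_mem, ReflClosed.delta⟩
  | @step S _ β _ _ hC hβ ih =>
    obtain ⟨γ₀, _, rfl⟩ := hC
    have hsub : orthSub S β ⊆ ctx.Δ := (Finset.filter_subset _ _).trans ih.1
    exact ⟨(Finset.filter_subset _ _).trans hsub, hβ.1, (ih.2.2.orthSub _).component hsub γ₀⟩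

/-- Every root of a cascade subsystem is non-orthogonal to some member of the cascade. -/
theorem CascadeMem.exists_inner_ne_zero {S : Finset V} {β : V} (h : ctx.CascadeMem S β) {γ : V}
    (hγ : γ ∈ S) : ∃ S' β', ctx.CascadeMem S' β' ∧ ⟪γ, β'⟫ ≠ 0 := by
  induction hn : S.card using Nat.strong_induction_on generalizing S β with
  | _ n ih =>
  subst hn
  by_cases hγβ : ⟪γ, β⟫ = 0
  · obtain ⟨hsub, hβ, hS⟩ := h.subset_mem_reflClosed
    have hγS : γ ∈ orthSub S β := Finset.mem_filter.2 ⟨hγ, hγβ⟩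
    have hγC : γ ∈ component (orthSub S β) γ := Finset.mem_filter.2 ⟨hγS, .refl⟩
    have hsub' : orthSub S β ⊆ ctx.Δ := (Finset.filter_subset _ _).trans hsub
    obtain ⟨β', hβ'⟩ := ((hS.orthSub β).component hsub' γ).exists_isHighest
      ((Finset.filter_subset _ _).trans hsub') ⟨γ, hγC⟩
      fun A hA hne horth => component_irreducible γ hA hne horth
    refine ih _ ?_ (h.step ⟨γ, hγS, rfl⟩ hβ') hγC rfl
    refine (Finset.card_le_card (Finset.filter_subset _ _)).trans_lt
      (Finset.card_lt_card (Finset.filter_ssubset.2 ⟨β, hβ, ?_⟩))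
    exact (inner_self_pos (hsub hβ)).ne'
  · exact ⟨S, β, h, hγβ⟩

/-- The real span of the cascade contains a vector orthogonal to no root. -/
theorem IsCascade.exists_regular {K : Finset V} (hK : ctx.IsCascade K) :
    ∃ v ∈ Submodule.span ℝ (K : Set V), ∀ γ ∈ ctx.Δ, ⟪γ, v⟫ ≠ 0 := by
  obtain ⟨v, hv, h⟩ := Module.Dual.exists_forall_mem_ne_zero_of_forall_exists
    (Submodule.span ℝ (K : Set V)) (fun γ : ctx.Δ => innerₗ V (γ : V)) (by
      rintro ⟨γ, hγ⟩
      obtain ⟨S, β, hβ, hne⟩ := CascadeMem.top.exists_inner_ne_zero hγ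
      exact ⟨β, Submodule.subset_span ((hK β).2 ⟨S, hβ⟩), hne⟩)
  exact ⟨v, hv, fun γ hγ => h ⟨γ, hγ⟩⟩

end RootSystemCtx

theorem LieRootData.coh_mem_span {V : Type*} [NormedAddCommGroup V] [InnerProductSpace ℝ V]
    {ctx : RootSystemCtx V} {g : Type*} [LieRing g] [LieAlgebra ℂ g] (d : LieRootData ctx g)
    {s : Set V} {v : V} (hv : v ∈ Submodule.span ℝ s) :
    d.coh v ∈ Submodule.span ℂ (d.coh '' s) := by
  induction hv using Submodule.span_induction with
  | mem x hx => exact Submodule.subset_span ⟨x, hx, rfl⟩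
  | zero =>
    have h := d.coh_smul 0 0
    rw [zero_smul, Complex.ofReal_zero, zero_smul] at h
    rw [h]
    exact zero_mem _
  | add x y _ _ hx hy => rw [d.coh_add]; exact add_mem hx hy
  | smul r x _ hx => rw [d.coh_smul]; exact Submodule.smul_mem _ _ hx

/-- The subalgebra `t_K` (the span of the cascade inside the Cartan subalgebra) contains a
regular semisimple element of `g`: an `h` with `γ(h) ≠ 0`, i.e. `⁅h, e_γ⁆ ≠ 0`, for every
root `γ`. -/
theorem tK_contains_regular_semisimple {V : Type*} [NormedAddCommGroup V] [InnerProductSpace ℝ V]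
    [FiniteDimensional ℝ V] (ctx : RootSystemCtx V)
    {g : Type*} [LieRing g] [LieAlgebra ℂ g] [FiniteDimensional ℂ g]
    (d : LieRootData ctx g)
    (K : Finset V) (hK : ctx.IsCascade K) :
    ∃ h ∈ Submodule.span ℂ (d.coh '' (K : Set V)), ∀ γ ∈ ctx.Δ, ⁅h, d.e γ⁆ ≠ 0 := by
  obtain ⟨v, hv, hreg⟩ := hK.exists_regular
  refine ⟨d.coh v, d.coh_mem_span hv, fun γ hγ => ?_⟩
  rw [d.bracket_coh_e v γ hγ]
  exact smul_ne_zero (by exact_mod_cast hreg γ hγ) (d.e_ne γ hγ)
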